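/- Let μ be a probability measure on ℝ^d with density proportional to exp(-U), where U is C² and satisfies ∇²U ⪰ αI for some α > 0, and let x* be the global minimizer of U. Then E_μ[‖· - x*‖²] ≤ d/α. -/

import Mathlib

open MeasureTheory Real

/-- Along rays from the minimizer, `U` grows at least quadratically. -/
lemma ray_growth {E : Type*} [NormedAddCommGroup E] [NormedSpace ℝ E] (α : ℝ)
    (U : E → ℝ) (hU : ContDiff ℝ 2 U)
    (hHess : ∀ x v : E, α * ‖v‖ ^ 2 ≤ (iteratedFDeriv ℝ 2 U x) ![v, v])
    (xs : E) (hmin : ∀ y, U xs ≤ U y) (v : E) (t : ℝ) (ht0 : 0 ≤ t) (ht1 : t ≤ 1) :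
    U (t • v + xs) + α * ‖v‖ ^ 2 * (1 - t ^ 2) / 2 ≤ U (v + xs) := by
  have hd1 : Differentiable ℝ U := hU.differentiable (by norm_num)
  have hd2 : Differentiable ℝ (fderiv ℝ U) :=
    (hU.fderiv_right (m := 1) (by norm_num)).differentiable (by norm_num)
  have hline : ∀ s : ℝ, HasDerivAt (fun s : ℝ => s • v + xs) v s := fun s => by
    simpa using ((hasDerivAt_id s).smul_const v).add_const xs
  have h1 : ∀ s : ℝ, HasDerivAt (fun s : ℝ => U (s • v + xs) - α * ‖v‖ ^ 2 * s ^ 2 / 2)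
      (fderiv ℝ U (s • v + xs) v - α * ‖v‖ ^ 2 * s) s := fun s => by
    have a := (hd1 (s • v + xs)).hasFDerivAt.comp_hasDerivAt s (hline s)
    have b := (((hasDerivAt_id s).pow 2).const_mul (α * ‖v‖ ^ 2)).div_const 2
    have c := a.sub b
    simp only [id, Nat.cast_ofNat, mul_one] at c
    refine (c.congr_deriv ?_)
    ring
  have h2 : ∀ s : ℝ, HasDerivAt (fun s : ℝ => fderiv ℝ U (s • v + xs) v - α * ‖v‖ ^ 2 * s)
      (fderiv ℝ (fderiv ℝ U) (s • v + xs) v v - α * ‖v‖ ^ 2) s := fun s => by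
    have a0 : HasDerivAt (fun s : ℝ => fderiv ℝ U (s • v + xs))
        (fderiv ℝ (fderiv ℝ U) (s • v + xs) v) s :=
      (hd2 (s • v + xs)).hasFDerivAt.comp_hasDerivAt s (hline s)
    have a : HasDerivAt (fun s : ℝ => fderiv ℝ U (s • v + xs) v)
        (fderiv ℝ (fderiv ℝ U) (s • v + xs) v v) s := by
      simpa using a0.clm_apply (hasDerivAt_const s v)
    have b : HasDerivAt (fun s : ℝ => α * ‖v‖ ^ 2 * s) (α * ‖v‖ ^ 2) s := by
      simpa using (hasDerivAt_id s).const_mul (α * ‖v‖ ^ 2)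
    exact a.sub b
  have hmono : Monotone (fun s : ℝ => fderiv ℝ U (s • v + xs) v - α * ‖v‖ ^ 2 * s) := by
    apply monotone_of_deriv_nonneg (fun s => (h2 s).differentiableAt)
    intro s
    rw [(h2 s).deriv]
    have := hHess (s • v + xs) v
    rw [iteratedFDeriv_two_apply] at this
    simpa using this
  have hz : fderiv ℝ U xs = 0 :=
    IsLocalMin.fderiv_eq_zero (Filter.Eventually.of_forall hmin)
  have hm : MonotoneOn (fun s : ℝ => U (s • v + xs) - α * ‖v‖ ^ 2 * s ^ 2 / 2) (Set.Ici 0) := by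
    apply monotoneOn_of_deriv_nonneg (convex_Ici 0)
      (fun s _ => (h1 s).continuousAt.continuousWithinAt)
      (fun s _ => (h1 s).differentiableAt.differentiableWithinAt)
    intro s hs
    rw [interior_Ici] at hs
    rw [(h1 s).deriv]
    have := hmono (le_of_lt hs)
    simpa [hz] using this
  have := hm (Set.mem_Ici.2 ht0) (Set.mem_Ici.2 zero_le_one) ht1
  simp only [one_smul] at this
  linarith

/-- Scalar limit `t → 1`. -/
lemma scalar_limit (d : ℕ) (C : ℝ)
    (h : ∀ t : ℝ, 0 < t → t < 1 → t ^ d * (1 + C * (1 - t ^ 2)) ≤ 1) : 2 * C ≤ d := by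
  have key : ∀ t : ℝ, 0 < t → t < 1 → C * (1 + t) * t ^ d ≤ ∑ k ∈ Finset.range d, t ^ k := by
    intro t h0 h1
    have hg := geom_sum_mul t d
    have := h t h0 h1
    have hp : 0 < 1 - t := by linarith
    refine le_of_mul_le_mul_right ?_ hp
    nlinarith
  have c1 : Filter.Tendsto (fun t : ℝ => C * (1 + t) * t ^ d) (nhdsWithin 1 (Set.Iio 1))
      (nhds (C * (1 + 1) * 1 ^ d)) :=
    ((by fun_prop : Continuous fun t : ℝ => C * (1 + t) * t ^ d).tendsto 1).mono_left
      nhdsWithin_le_nhds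
  have c2 : Filter.Tendsto (fun t : ℝ => ∑ k ∈ Finset.range d, t ^ k) (nhdsWithin 1 (Set.Iio 1))
      (nhds (∑ k ∈ Finset.range d, (1 : ℝ) ^ k)) :=
    ((by fun_prop : Continuous fun t : ℝ => ∑ k ∈ Finset.range d, t ^ k).tendsto 1).mono_left
      nhdsWithin_le_nhds
  have := le_of_tendsto_of_tendsto c1 c2 (by
    filter_upwards [Ioo_mem_nhdsLT (zero_lt_one (α := ℝ))] with t ht
    exact key t ht.1 ht.2)
  simp at this
  linarith

/-- If `μ ∝ exp(-U)` on `ℝ^d` with `U` of class `C²` and `∇²U ⪰ αI` (so `U` is `α`-strongly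
convex), and `x*` is the global minimizer of `U`, then `E_μ ‖· - x*‖² ≤ d / α`. -/
theorem expectation_dist_sq_le_of_strongly_convex (d : ℕ) (α : ℝ) (hα : 0 < α)
    (U : EuclideanSpace ℝ (Fin d) → ℝ) (hU : ContDiff ℝ 2 U)
    (hHess : ∀ x v : EuclideanSpace ℝ (Fin d),
      α * ‖v‖ ^ 2 ≤ (iteratedFDeriv ℝ 2 U x) ![v, v])
    (xstar : EuclideanSpace ℝ (Fin d)) (hmin : ∀ y, U xstar ≤ U y)
    (hint : Integrable (fun x => Real.exp (-U x)) volume) :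
    ∫ x, ‖x - xstar‖ ^ 2 * (Real.exp (-U x) / ∫ y, Real.exp (-U y)) ≤ d / α := by
  set Z := ∫ y, Real.exp (-U y) with hZ
  have hZpos : 0 < Z := integral_exp_pos hint
  rw [← integral_add_right_eq_self _ xstar]
  simp only [add_sub_cancel_right]
  by_cases hI : Integrable (fun x => ‖x‖ ^ 2 * (Real.exp (-U (x + xstar)) / Z)) volume
  swap
  · rw [integral_undef hI]
    positivity
  set I := ∫ x, ‖x‖ ^ 2 * (Real.exp (-U (x + xstar)) / Z) with hIdef
  have hf : Integrable (fun x => Real.exp (-U (x + xstar))) volume := hint.comp_add_right xstar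
  have hfZ : ∫ x, Real.exp (-U (x + xstar)) = Z :=
    integral_add_right_eq_self (fun x => Real.exp (-U x)) xstar
  have := scalar_limit d (α * I / 2) (by
    intro t h0 h1
    have e : ∫ x, Real.exp (-U (t • x + xstar)) = (t ^ d)⁻¹ * Z := by
      have := Measure.integral_comp_smul volume
        (fun x : EuclideanSpace ℝ (Fin d) => Real.exp (-U (x + xstar))) t
      rw [this, hfZ, finrank_euclideanSpace_fin, abs_of_pos (by positivity), smul_eq_mul]
    have it : Integrable (fun x => Real.exp (-U (t • x + xstar))) volume :=
      hf.comp_smul h0.ne'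
    have le : ∫ x, (Real.exp (-U (x + xstar)) +
        (Z * (α * (1 - t ^ 2) / 2)) * (‖x‖ ^ 2 * (Real.exp (-U (x + xstar)) / Z))) ≤
        ∫ x, Real.exp (-U (t • x + xstar)) := by
      refine integral_mono (hf.add (hI.const_mul _)) it fun x => ?_
      have hr := ray_growth α U hU hHess xstar hmin x t h0.le h1.le
      have h3 : Real.exp (-U (x + xstar)) * Real.exp (α * ‖x‖ ^ 2 * (1 - t ^ 2) / 2) ≤
          Real.exp (-U (t • x + xstar)) := by
        rw [← Real.exp_add]
        exact Real.exp_le_exp.2 (by linarith)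
      have h4 := mul_le_mul_of_nonneg_left (Real.add_one_le_exp (α * ‖x‖ ^ 2 * (1 - t ^ 2) / 2))
        (Real.exp_pos (-U (x + xstar))).le
      refine le_trans (le_of_eq ?_) (h4.trans h3)
      field_simp
      ring
    rw [integral_add hf (hI.const_mul _), integral_const_mul, hfZ, e, ← hIdef] at le
    have hp : 0 < t ^ d := by positivity
    have h5 := mul_le_mul_of_nonneg_left le hp.le
    rw [← mul_assoc, mul_inv_cancel₀ hp.ne', one_mul] at h5
    refine le_of_mul_le_mul_right ?_ hZpos
    linarith)
  rw [le_div_iff₀ hα]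
  linarith
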